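/- arXiv:1412.1959 — 7 statements merged into one kernel-verified Lean document; each statement's English description precedes it below -/
import Mathlib

section
/- Let θ > 0 and 0 ≤ γ ≤ 1. Let z₀, z₁, z₂ be complex numbers with Re z₁ ≤ 0, Re z₂ ≤ 0 and |z₀| ≤ 2γ·√((Re z₁)·(Re z₂)), and set p = (1 − θz₁)(1 − θz₂). Then p ≠ 0 and |1 + z₀/(2p) + (1/2 − θ)(z₁+z₂)/p| is at most: 1/(2θ) − 3/2 if 0 < θ < 1/6; 3/2 if 1/6 ≤ θ ≤ 1; and 2 − 1/(2θ) if θ > 1. -/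
lemma norm_sq_one_sub_sub_norm_sq_one_add (θ : ℝ) (z : ℂ) :
    ‖1 - (θ : ℂ) * z‖ ^ 2 - ‖1 + (θ : ℂ) * z‖ ^ 2 = -(4 * θ * z.re) := by
  rw [Complex.sq_norm, Complex.sq_norm, Complex.normSq_apply, Complex.normSq_apply]
  simp
  ring

lemma norm_one_add_le_norm_one_sub {θ : ℝ} (hθ : 0 ≤ θ) {z : ℂ} (hz : z.re ≤ 0) :
    ‖1 + (θ : ℂ) * z‖ ≤ ‖1 - (θ : ℂ) * z‖ := by
  have h := norm_sq_one_sub_sub_norm_sq_one_add θ z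
  have h' := mul_nonneg hθ (neg_nonneg.2 hz)
  exact (sq_le_sq₀ (norm_nonneg _) (norm_nonneg _)).1 (by linarith)

lemma one_sub_mul_ne_zero {θ : ℝ} (hθ : 0 ≤ θ) {z : ℂ} (hz : z.re ≤ 0) :
    1 - (θ : ℂ) * z ≠ 0 := by
  intro h
  have hre := congrArg Complex.re h
  simp at hre
  nlinarith [mul_nonneg hθ (neg_nonneg.2 hz)]

lemma four_mul_sqrt_re_mul_re_le {θ : ℝ} (hθ : 0 ≤ θ) {z₁ z₂ : ℂ} (h1 : z₁.re ≤ 0)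
    (h2 : z₂.re ≤ 0) :
    4 * θ * Real.sqrt (z₁.re * z₂.re) ≤
      ‖1 - (θ : ℂ) * z₁‖ * ‖1 - (θ : ℂ) * z₂‖ - ‖1 + (θ : ℂ) * z₁‖ * ‖1 + (θ : ℂ) * z₂‖ := by
  have e1 := norm_sq_one_sub_sub_norm_sq_one_add θ z₁
  have e2 := norm_sq_one_sub_sub_norm_sq_one_add θ z₂
  have hmul := mul_le_mul (norm_one_add_le_norm_one_sub hθ h1)
    (norm_one_add_le_norm_one_sub hθ h2) (norm_nonneg _) (norm_nonneg _)
  generalize ‖1 - (θ : ℂ) * z₁‖ = a at *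
  generalize ‖1 - (θ : ℂ) * z₂‖ = b at *
  generalize ‖1 + (θ : ℂ) * z₁‖ = m at *
  generalize ‖1 + (θ : ℂ) * z₂‖ = n at *
  refine abs_le_of_sq_le_sq' ?_ (by linarith) |>.2
  rw [mul_pow, Real.sq_sqrt (mul_nonneg_of_nonpos_of_nonpos h1 h2)]
  have : (4 * θ) ^ 2 * (z₁.re * z₂.re) = (a ^ 2 - m ^ 2) * (b ^ 2 - n ^ 2) := by
    rw [e1, e2]; ring
  rw [this]
  nlinarith [sq_nonneg (a * n - b * m)]

/-- The scalar maximisation: the left side is affine in `r ∈ [0, 1]`. -/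
lemma affine_symbol_bound {θ r : ℝ} (hθ : 0 < θ) (hr0 : 0 ≤ r) (hr1 : r ≤ 1) :
    |(3 - 1 / (2 * θ)) / 2| + |(1 / (2 * θ) - 1) / 2| * r + 1 / (2 * θ) / 2 * (1 - r) ≤
      (if θ < 1 / 6 then 1 / (2 * θ) - 3 / 2
       else if θ ≤ 1 then 3 / 2
       else 2 - 1 / (2 * θ)) := by
  have hκ : θ * (1 / (2 * θ)) = 1 / 2 := by field_simp
  have hκ0 : 0 < 1 / (2 * θ) := by positivity
  generalize 1 / (2 * θ) = κ at *
  split_ifs with h h'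
  · have : 3 < κ := by nlinarith
    rw [abs_of_nonpos (by linarith), abs_of_nonneg (by linarith)]
    nlinarith
  · have : κ ≤ 3 := by nlinarith
    have : 1 / 2 ≤ κ := by nlinarith
    rw [abs_of_nonneg (by linarith)]
    rcases abs_cases ((κ - 1) / 2) with ⟨e, _⟩ | ⟨e, _⟩ <;> rw [e] <;> nlinarith
  · have : κ < 1 / 2 := by nlinarith
    rw [abs_of_nonneg (by linarith), abs_of_nonpos (by linarith)]
    nlinarith

/-- Theorem 2 of the paper: bound on the scalar symbol
`1 + z₀/(2p) + (1/2 − θ)(z₁+z₂)/p` with `p = (1 − θz₁)(1 − θz₂)`, under the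
von Neumann condition `Re z₁ ≤ 0`, `Re z₂ ≤ 0`, `|z₀| ≤ 2γ√((Re z₁)(Re z₂))`. -/
theorem stmt_3 (θ γ : ℝ) (hθ : 0 < θ) (hγ0 : 0 ≤ γ) (hγ1 : γ ≤ 1)
    (z₀ z₁ z₂ : ℂ) (h1 : z₁.re ≤ 0) (h2 : z₂.re ≤ 0)
    (h0 : ‖z₀‖ ≤ 2 * γ * Real.sqrt (z₁.re * z₂.re))
    (p : ℂ) (hp : p = (1 - (θ : ℂ) * z₁) * (1 - (θ : ℂ) * z₂)) :
    p ≠ 0 ∧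
    ‖1 + z₀ / (2 * p) + ((1 / 2 : ℂ) - (θ : ℂ)) * (z₁ + z₂) / p‖ ≤
      (if θ < 1 / 6 then 1 / (2 * θ) - 3 / 2
       else if θ ≤ 1 then 3 / 2
       else 2 - 1 / (2 * θ)) := by
  have hp0 : p ≠ 0 :=
    hp ▸ mul_ne_zero (one_sub_mul_ne_zero hθ.le h1) (one_sub_mul_ne_zero hθ.le h2)
  refine ⟨hp0, ?_⟩
  obtain ⟨q, hq⟩ : ∃ q, q = (1 + (θ : ℂ) * z₁) * (1 + (θ : ℂ) * z₂) := ⟨_, rfl⟩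
  have hsqrt := four_mul_sqrt_re_mul_re_le hθ.le h1 h2
  rw [← norm_mul, ← norm_mul, ← hp, ← hq] at hsqrt
  have hP : 0 < ‖p‖ := norm_pos_iff.2 hp0
  have hs0 := Real.sqrt_nonneg (z₁.re * z₂.re)
  have hqp : ‖q‖ ≤ ‖p‖ := by nlinarith [mul_nonneg hθ.le hs0]
  have hz₀ : ‖z₀ / (2 * p)‖ ≤ 1 / (2 * θ) / 2 * (1 - ‖q‖ / ‖p‖) := by
    have hz : 2 * θ * ‖z₀‖ ≤ ‖p‖ - ‖q‖ := by
      have : ‖z₀‖ ≤ 2 * Real.sqrt (z₁.re * z₂.re) := by nlinarith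
      nlinarith
    have e : 1 / (2 * θ) / 2 * (1 - ‖q‖ / ‖p‖) = (‖p‖ - ‖q‖) / (2 * θ) / (2 * ‖p‖) := by
      field_simp
    rw [e, norm_div, norm_mul, Complex.norm_ofNat]
    gcongr
    rw [le_div_iff₀ (by positivity)]
    linarith
  have hsplit : 1 + z₀ / (2 * p) + ((1 / 2 : ℂ) - (θ : ℂ)) * (z₁ + z₂) / p =
      (((3 - 1 / (2 * θ)) / 2 : ℝ) : ℂ) + (((1 / (2 * θ) - 1) / 2 : ℝ) : ℂ) * (q / p)
        + z₀ / (2 * p) := by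
    have hθ' : (θ : ℂ) ≠ 0 := by exact_mod_cast hθ.ne'
    have hdiff : q = p + 2 * θ * (z₁ + z₂) := by rw [hq, hp]; ring
    rw [hdiff]
    push_cast
    field_simp
    ring
  calc _ ≤ |(3 - 1 / (2 * θ)) / 2| + |(1 / (2 * θ) - 1) / 2| * (‖q‖ / ‖p‖)
        + 1 / (2 * θ) / 2 * (1 - ‖q‖ / ‖p‖) := by
        rw [hsplit]
        refine (norm_add₃_le).trans ?_
        rw [norm_mul, norm_div q p, Complex.norm_real, Complex.norm_real, Real.norm_eq_abs,
          Real.norm_eq_abs]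
        gcongr
    _ ≤ _ := affine_symbol_bound hθ (by positivity) ((div_le_one hP).2 hqp)
end

section
/- Let θ ≥ 1/2 and 0 ≤ γ ≤ 1. Let z₀, z₁, z₂ be complex numbers with Re z₁ ≤ 0, Re z₂ ≤ 0 and |z₀| ≤ 2γ·√((Re z₁)·(Re z₂)), and set p = (1 − θz₁)(1 − θz₂). Then |p + z₀/2 + (1/2 − θ)(z₁ + z₂)| ≥ 1. -/
/-- Case `θ ≥ 1/2` of Theorem 3 of the paper:
`|p + z₀/2 + (1/2 − θ)(z₁ + z₂)| ≥ 1` where `p = (1 − θz₁)(1 − θz₂)`. -/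
theorem stmt_5 (θ γ : ℝ) (hθ : 1 / 2 ≤ θ) (hγ0 : 0 ≤ γ) (hγ1 : γ ≤ 1)
    (z₀ z₁ z₂ : ℂ) (h1 : z₁.re ≤ 0) (h2 : z₂.re ≤ 0)
    (h0 : ‖z₀‖ ≤ 2 * γ * Real.sqrt (z₁.re * z₂.re))
    (p : ℂ) (hp : p = (1 - (θ : ℂ) * z₁) * (1 - (θ : ℂ) * z₂)) :
    1 ≤ ‖p + z₀ / 2 + ((1 / 2 : ℂ) - (θ : ℂ)) * (z₁ + z₂)‖ := by
  set a : ℝ := 2 * θ - 1 / 2 with ha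
  set t : ℝ := √(z₁.re * z₂.re) with ht
  have ht0 : 0 ≤ t := Real.sqrt_nonneg _
  have ht2 : t ^ 2 = z₁.re * z₂.re := Real.sq_sqrt (mul_nonneg_of_nonpos_of_nonpos h1 h2)
  have hz0 : ‖z₀ / 2‖ ≤ t := by
    rw [norm_div, Complex.norm_two]
    nlinarith [mul_le_mul_of_nonneg_right hγ1 ht0]
  have amgm : 2 * t ≤ -z₁.re + -z₂.re := by
    refine (abs_le_of_sq_le_sq' ?_ (by linarith)).2
    nlinarith [sq_nonneg (z₁.re - z₂.re)]
  set q : ℂ := p + ((1 / 2 : ℂ) - (θ : ℂ)) * (z₁ + z₂) with hq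
  have factor : ((θ ^ 2 : ℝ) : ℂ) * q + ((a ^ 2 - θ ^ 2 : ℝ) : ℂ) =
      ((a : ℂ) - (θ : ℂ) ^ 2 * z₁) * ((a : ℂ) - (θ : ℂ) ^ 2 * z₂) := by
    rw [hq, hp, ha]
    push_cast
    ring
  have re_le (z : ℂ) : a - θ ^ 2 * z.re ≤ ‖(a : ℂ) - (θ : ℂ) ^ 2 * z‖ := by
    have h := Complex.re_le_norm ((a : ℂ) - (θ : ℂ) ^ 2 * z)
    rwa [Complex.sub_re, ← Complex.ofReal_pow, Complex.re_ofReal_mul, Complex.ofReal_re,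
      Complex.ofReal_pow] at h
  have hpos (x : ℝ) (hx : x ≤ 0) : 0 ≤ a - θ ^ 2 * x := by
    nlinarith [mul_nonneg (sq_nonneg θ) (neg_nonneg.2 hx)]
  have lower := mul_le_mul (re_le z₁) (re_le z₂) (hpos _ h2) (norm_nonneg _)
  have upper := norm_add_le (((θ ^ 2 : ℝ) : ℂ) * q) ((a ^ 2 - θ ^ 2 : ℝ) : ℂ)
  rw [factor, norm_mul, norm_mul, Complex.norm_of_nonneg (sq_nonneg θ),
    Complex.norm_of_nonneg (by nlinarith : 0 ≤ a ^ 2 - θ ^ 2)] at upper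
  have scaled : θ ^ 2 * (θ ^ 2 * t ^ 2 + a * (-z₁.re + -z₂.re) + 1) ≤ θ ^ 2 * ‖q‖ := by
    rw [ht2]
    linarith
  have hqt : 1 + t ≤ ‖q‖ := by
    have h := le_of_mul_le_mul_left scaled (by positivity)
    have ha2 : 1 / 2 ≤ a := by linarith
    nlinarith [mul_le_mul_of_nonneg_left amgm (by linarith : 0 ≤ a),
      mul_le_mul_of_nonneg_right ha2 ht0, mul_nonneg (sq_nonneg θ) (sq_nonneg t)]
  have split : p + z₀ / 2 + ((1 / 2 : ℂ) - (θ : ℂ)) * (z₁ + z₂) = q + z₀ / 2 := by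
    rw [hq]
    ring
  rw [split]
  linarith [norm_sub_le_norm_add q (z₀ / 2)]
end

section
/- Let θ ≥ 1/2 and let z₀, z₁, z₂ be complex numbers with Re z₁ ≤ 0, Re z₂ ≤ 0 and |z₀| ≤ 2·√((Re z₁)·(Re z₂)), and set p = (1 − θz₁)(1 − θz₂). Then |p + z₀/2 + (1/2 − θ)(z₁ + z₂)| ≥ 1 + 2(2θ − 1)·√((Re z₁)·(Re z₂)). -/
/-- Lower bound for the squared modulus of `1 + c * (w + w') + t ^ 2 * (w * w')`, where
`w = a + b * I` and `w' = a' + b' * I` lie in the closed right half plane and `s` is the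
geometric mean of `a` and `a'`. -/
theorem sq_one_add_le_of_re_nonneg {t c a a' b b' s : ℝ} (ht : 0 ≤ t) (htc : t ≤ c)
    (ha : 0 ≤ a) (ha' : 0 ≤ a') (hs : 0 ≤ s) (hss : s ^ 2 = a * a') :
    (1 + 2 * c * s) ^ 2 ≤
      (1 + c * (a + a') + t ^ 2 * (a * a' - b * b')) ^ 2 +
        (c * (b + b') + t ^ 2 * (a * b' + a' * b)) ^ 2 := by
  have hc : 0 ≤ c := ht.trans htc
  have haa : 0 ≤ a * a' := mul_nonneg ha ha'
  have hsum : 2 * s ≤ a + a' :=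
    le_of_abs_le (abs_le_of_sq_le_sq (by linarith [sq_nonneg (a - a')]) (by positivity))
  have hcs : 2 * c * s ≤ c * (a + a') := by nlinarith
  have hcs0 : 0 ≤ 2 * c * s := by positivity
  have hta : 0 ≤ t ^ 2 * (a * a') := by positivity
  have htc2 : t ^ 2 ≤ c ^ 2 := by gcongr
  rcases le_total (b * b') 0 with hb | hb
  · have h : 0 ≤ t ^ 2 * (a * a' - b * b') := mul_nonneg (sq_nonneg t) (by linarith)
    have h' : (1 + 2 * c * s) ^ 2 ≤ (1 + c * (a + a') + t ^ 2 * (a * a' - b * b')) ^ 2 :=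
      pow_le_pow_left₀ (by linarith) (by linarith) 2
    linarith [sq_nonneg (c * (b + b') + t ^ 2 * (a * b' + a' * b))]
  · have hA : (1 + 2 * c * s) ^ 2 ≤ (1 + c * (a + a') + t ^ 2 * (a * a')) ^ 2 :=
      pow_le_pow_left₀ (by linarith) (by linarith) 2
    have hI : 4 * (b * b') * ((c + t ^ 2 * a) * (c + t ^ 2 * a')) ≤
        (c * (b + b') + t ^ 2 * (a * b' + a' * b)) ^ 2 := by
      linarith [sq_nonneg (b * (c + t ^ 2 * a') - b' * (c + t ^ 2 * a))]
    have hcoef : 0 ≤ 4 * ((c + t ^ 2 * a) * (c + t ^ 2 * a')) -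
        2 * t ^ 2 * (1 + c * (a + a') + t ^ 2 * (a * a')) := by
      have h₁ : 0 ≤ c * t ^ 2 * (a + a') := by positivity
      have h₂ : 0 ≤ t ^ 2 * t ^ 2 * (a * a') := by positivity
      linarith [sq_nonneg c]
    linarith [mul_nonneg hb hcoef, sq_nonneg (t ^ 2 * (b * b'))]

/-- Lower bound for the modulus of `1 - c * (z + z') + t ^ 2 * (z * z')` in the closed left half
plane. -/
theorem one_add_le_norm_of_re_nonpos {t c : ℝ} (ht : 0 ≤ t) (htc : t ≤ c) {z z' : ℂ}
    (hz : z.re ≤ 0) (hz' : z'.re ≤ 0) :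
    1 + 2 * c * Real.sqrt (z.re * z'.re) ≤ ‖1 - (c : ℂ) * (z + z') + (t : ℂ) ^ 2 * (z * z')‖ := by
  refine le_of_abs_le (abs_le_of_sq_le_sq ?_ (norm_nonneg _))
  have h := sq_one_add_le_of_re_nonneg (b := -z.im) (b' := -z'.im) ht htc
    (neg_nonneg.2 hz) (neg_nonneg.2 hz') (Real.sqrt_nonneg (z.re * z'.re))
    (by rw [Real.sq_sqrt (mul_nonneg_of_nonpos_of_nonpos hz hz')]; ring)
  rw [← Complex.normSq_eq_norm_sq, Complex.normSq_apply]
  refine h.trans_eq ?_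
  simp [← Complex.ofReal_pow]
  ring


/-- Sharper intermediate inequality in the proof of the case `θ ≥ 1/2` of the
paper's Theorem 3: `|p + z₀/2 + (1/2 − θ)(z₁ + z₂)| ≥ 1 + 2(2θ − 1)√((Re z₁)(Re z₂))`. -/
theorem stmt_6 (θ : ℝ) (hθ : 1 / 2 ≤ θ)
    (z₀ z₁ z₂ : ℂ) (h1 : z₁.re ≤ 0) (h2 : z₂.re ≤ 0)
    (h0 : ‖z₀‖ ≤ 2 * Real.sqrt (z₁.re * z₂.re))
    (p : ℂ) (hp : p = (1 - (θ : ℂ) * z₁) * (1 - (θ : ℂ) * z₂)) :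
    1 + 2 * (2 * θ - 1) * Real.sqrt (z₁.re * z₂.re) ≤
      ‖p + z₀ / 2 + ((1 / 2 : ℂ) - (θ : ℂ)) * (z₁ + z₂)‖ := by
  have hmain := one_add_le_norm_of_re_nonpos (t := θ) (c := 2 * θ - 1 / 2)
    (by linarith) (by linarith) h1 h2
  have heq : p + z₀ / 2 + ((1 / 2 : ℂ) - (θ : ℂ)) * (z₁ + z₂) =
      (1 - ((2 * θ - 1 / 2 : ℝ) : ℂ) * (z₁ + z₂) + (θ : ℂ) ^ 2 * (z₁ * z₂)) + z₀ / 2 := by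
    rw [hp]
    push_cast
    ring
  have hnorm : ‖z₀ / 2‖ = ‖z₀‖ / 2 := by simp
  rw [heq]
  linarith [norm_sub_le_norm_add
    (1 - ((2 * θ - 1 / 2 : ℝ) : ℂ) * (z₁ + z₂) + (θ : ℂ) ^ 2 * (z₁ * z₂)) (z₀ / 2)]
end

section
/- Let 1/4 ≤ θ < 1/2 and 0 ≤ γ < 2θ. Let z₀, z₁, z₂ be complex numbers with Re z₁ ≤ 0, Re z₂ ≤ 0 and |z₀| ≤ 2γ·√((Re z₁)·(Re z₂)), and set p = (1 − θz₁)(1 − θz₂). Then |p + z₀/2 + (1/2 − θ)(z₁ + z₂)| ≥ (θ − 1/4)/θ². -/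
/-- The squared form of the lower bound for `‖u₁ * u₂ + (1 - m ^ 2)‖`, where `g` is the geometric
mean of the real parts of `u₁, u₂`, and `P`, `Q` are the product of their imaginary parts and the
imaginary part of `u₁ * u₂`. -/
lemma sq_two_mul_sub_sq_le {m g P Q : ℝ} (hm : 0 ≤ m) (hm1 : m ≤ 1) (hg : m ≤ g)
    (hQ : 4 * g ^ 2 * P ≤ Q ^ 2) :
    (2 * g - m ^ 2) ^ 2 ≤ (g ^ 2 + (1 - m ^ 2) - P) ^ 2 + Q ^ 2 := by
  have hnonneg : 0 ≤ 2 * g - m ^ 2 := by nlinarith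
  have hle : (2 * g - m ^ 2) ^ 2 ≤ (g ^ 2 + (1 - m ^ 2)) ^ 2 :=
    pow_le_pow_left₀ hnonneg (by nlinarith [sq_nonneg (g - 1)]) 2
  have hA : 0 ≤ g ^ 2 + (1 - m ^ 2) := by nlinarith
  rcases le_total P 0 with hP | hP
  · nlinarith [sq_nonneg Q, sq_nonneg P, mul_nonneg hA (neg_nonneg.2 hP)]
  rcases le_total (1 - m ^ 2) (g ^ 2) with hK | hK
  · nlinarith [mul_nonneg hP (sub_nonneg.2 hK), sq_nonneg P]
  have hdisc : 0 ≤ 4 * g - 4 * g ^ 2 - m ^ 2 := by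
    rcases le_total g (4 / 5) with h | h
    · nlinarith [mul_nonneg (hm.trans hg) (sub_nonneg.2 h)]
    · have : g ≤ 1 := by nlinarith [sq_nonneg m]
      nlinarith
  nlinarith [mul_nonneg (sq_nonneg m) hdisc, sq_nonneg (P + g ^ 2 - (1 - m ^ 2))]

lemma Real.sqrt_sub_mul_sub_le {m a b : ℝ} (hm : 0 ≤ m) (ha : m ≤ a) (hb : m ≤ b) :
    √((a - m) * (b - m)) ≤ √(a * b) - m := by
  have hmg : m ≤ √(a * b) := Real.le_sqrt_of_sq_le (by nlinarith)
  have hsq : √(a * b) ^ 2 = a * b := Real.sq_sqrt (by nlinarith)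
  have hg : √(a * b) ≤ (a + b) / 2 :=
    Real.sqrt_le_iff.2 ⟨by linarith, by nlinarith [sq_nonneg (a - b)]⟩
  exact Real.sqrt_le_iff.2 ⟨by linarith, by nlinarith⟩

lemma Complex.le_norm_mul_add_one_sub_sq {m : ℝ} (hm : 0 ≤ m) (hm1 : m ≤ 1) {u v : ℂ}
    (hu : m ≤ u.re) (hv : m ≤ v.re) :
    m * (2 - m) + 2 * √((u.re - m) * (v.re - m)) ≤ ‖u * v + (1 - (m : ℂ) ^ 2)‖ := by
  have hmg : m ≤ √(u.re * v.re) := Real.le_sqrt_of_sq_le (by nlinarith)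
  have hsq : √(u.re * v.re) ^ 2 = u.re * v.re := Real.sq_sqrt (by nlinarith)
  have key := sq_two_mul_sub_sq_le (P := u.im * v.im) (Q := u.re * v.im + u.im * v.re) hm hm1 hmg
    (by rw [hsq]; nlinarith [sq_nonneg (u.re * v.im - u.im * v.re)])
  have hcast : u * v + (1 - (m : ℂ) ^ 2) = u * v + ((1 - m ^ 2 : ℝ) : ℂ) := by push_cast; rfl
  have hnorm : (2 * √(u.re * v.re) - m ^ 2) ^ 2 ≤ ‖u * v + (1 - (m : ℂ) ^ 2)‖ ^ 2 := by
    rw [hcast, Complex.sq_norm, Complex.normSq_apply]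
    simp only [Complex.add_re, Complex.add_im, Complex.mul_re, Complex.mul_im, Complex.ofReal_re,
      Complex.ofReal_im]
    rw [hsq] at key
    linarith
  have := (le_abs_self _).trans (abs_le_of_sq_le_sq hnorm (norm_nonneg _))
  linarith [Real.sqrt_sub_mul_sub_le hm hu hv]

/-- Case `1/4 ≤ θ < 1/2`, `0 ≤ γ < 2θ` of Theorem 3 of the paper:
`|p + z₀/2 + (1/2 − θ)(z₁ + z₂)| ≥ (θ − 1/4)/θ²` where `p = (1 − θz₁)(1 − θz₂)`. -/
theorem stmt_7 (θ γ : ℝ) (hθ1 : 1 / 4 ≤ θ) (hθ2 : θ < 1 / 2)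
    (hγ0 : 0 ≤ γ) (hγ1 : γ < 2 * θ)
    (z₀ z₁ z₂ : ℂ) (h1 : z₁.re ≤ 0) (h2 : z₂.re ≤ 0)
    (h0 : ‖z₀‖ ≤ 2 * γ * Real.sqrt (z₁.re * z₂.re))
    (p : ℂ) (hp : p = (1 - (θ : ℂ) * z₁) * (1 - (θ : ℂ) * z₂)) :
    (θ - 1 / 4) / θ ^ 2 ≤
      ‖p + z₀ / 2 + ((1 / 2 : ℂ) - (θ : ℂ)) * (z₁ + z₂)‖ := by
  have hθ : 0 < θ := by linarith
  obtain ⟨m, hm⟩ : ∃ m : ℝ, m = 2 - 1 / (2 * θ) := ⟨_, rfl⟩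
  have hmθ : m * θ = 2 * θ - 1 / 2 := by rw [hm]; field_simp
  have hm0 : 0 ≤ m := by
    by_contra! h
    nlinarith
  have hm1 : m ≤ 1 := by
    by_contra! h
    nlinarith
  have hre (z : ℂ) : ((m : ℂ) - θ * z).re - m = -(θ * z.re) := by simp
  have hle {z : ℂ} (hz : z.re ≤ 0) : m ≤ ((m : ℂ) - θ * z).re := by
    nlinarith [hre z]
  have key := Complex.le_norm_mul_add_one_sub_sq hm0 hm1 (hle h1) (hle h2)
  have hsqrt : √(-(θ * z₁.re) * -(θ * z₂.re)) = θ * √(z₁.re * z₂.re) := by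
    rw [show -(θ * z₁.re) * -(θ * z₂.re) = θ ^ 2 * (z₁.re * z₂.re) by ring,
      Real.sqrt_mul (sq_nonneg θ), Real.sqrt_sq hθ.le]
  rw [hre, hre, hsqrt] at key
  have hlhs : (θ - 1 / 4) / θ ^ 2 = m * (2 - m) := by rw [hm]; field_simp; ring
  have hmθC : (m : ℂ) * θ = 2 * θ - 1 / 2 := by
    have := congrArg (fun x : ℝ => (x : ℂ)) hmθ
    push_cast at this
    exact this
  have heq : p + z₀ / 2 + ((1 / 2 : ℂ) - (θ : ℂ)) * (z₁ + z₂) =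
      ((m - θ * z₁) * (m - θ * z₂) + (1 - (m : ℂ) ^ 2)) + z₀ / 2 := by
    rw [hp]
    linear_combination (z₁ + z₂) * hmθC
  have hz₀ : ‖z₀ / 2‖ ≤ 2 * (θ * √(z₁.re * z₂.re)) := by
    rw [norm_div, Complex.norm_ofNat]
    nlinarith [mul_nonneg (sub_nonneg.2 hγ1.le) (Real.sqrt_nonneg (z₁.re * z₂.re))]
  rw [heq, hlhs]
  linarith [norm_sub_le_norm_add ((m - θ * z₁) * (m - θ * z₂) + (1 - (m : ℂ) ^ 2)) (z₀ / 2)]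
end

section
/- Let 1/4 ≤ θ < 1/2 and 2θ ≤ γ ≤ min{6θ − 1, 1}. Let z₀, z₁, z₂ be complex numbers with Re z₁ ≤ 0, Re z₂ ≤ 0 and |z₀| ≤ 2γ·√((Re z₁)·(Re z₂)), and set p = (1 − θz₁)(1 − θz₂). Then |p + z₀/2 + (1/2 − θ)(z₁ + z₂)| ≥ −3(θ − (1+γ)/6)(θ − (1+γ)/2)/θ². -/
theorem four_mul_mul_sq_le_normSq (k B x₁ x₂ y₁ y₂ : ℝ) (hk : 0 ≤ k)
    (hB : B ^ 2 ≤ x₁ * x₂) :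
    4 * k * B ^ 2 ≤ (x₁ * x₂ - y₁ * y₂ + k) ^ 2 + (x₁ * y₂ + x₂ * y₁) ^ 2 := by
  have hkB := mul_le_mul_of_nonneg_left hB hk
  rcases le_total 0 (y₁ * y₂) with hy | hy
  · nlinarith [sq_nonneg (x₁ * x₂ + y₁ * y₂ - k), sq_nonneg (x₁ * y₂ - x₂ * y₁)]
  · nlinarith [sq_nonneg (x₁ * x₂ - y₁ * y₂ - k), sq_nonneg (x₁ * y₂ + x₂ * y₁)]

theorem sq_add_sq_le_normSq (k B x₁ x₂ y₁ y₂ : ℝ) (hk : 0 ≤ k) (hkB : k ≤ B ^ 2)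
    (hB : B ^ 2 ≤ x₁ * x₂) :
    (B ^ 2 + k) ^ 2 ≤ (x₁ * x₂ - y₁ * y₂ + k) ^ 2 + (x₁ * y₂ + x₂ * y₁) ^ 2 := by
  have hP : (B ^ 2 + k) ^ 2 ≤ (x₁ * x₂ + k) ^ 2 :=
    pow_le_pow_left₀ (by positivity) (by linarith) 2
  refine hP.trans ?_
  rcases le_total 0 (y₁ * y₂) with hy | hy
  · nlinarith [mul_nonneg hy (sub_nonneg.2 (hkB.trans hB)), sq_nonneg (x₁ * y₂ - x₂ * y₁),
      sq_nonneg (y₁ * y₂)]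
  · have h : (x₁ * x₂ + k) ^ 2 ≤ (x₁ * x₂ - y₁ * y₂ + k) ^ 2 :=
      pow_le_pow_left₀ (by linarith [sq_nonneg B]) (by linarith) 2
    linarith [sq_nonneg (x₁ * y₂ + x₂ * y₁)]

theorem one_sub_sq_add_le_norm (b g m : ℝ) (w₁ w₂ : ℂ) (hb : 0 ≤ b) (hb1 : b ≤ 1) (hg : 1 ≤ g)
    (hm : 0 ≤ m) (h₁ : 0 ≤ w₁.re) (h₂ : 0 ≤ w₂.re) (hmw : m ^ 2 = w₁.re * w₂.re) :
    1 - (g - b) ^ 2 + 2 * g * m ≤ ‖1 + (b : ℂ) * (w₁ + w₂) + w₁ * w₂‖ := by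
  have hnorm : ‖1 + (b : ℂ) * (w₁ + w₂) + w₁ * w₂‖ ^ 2 =
      ((b + w₁.re) * (b + w₂.re) - w₁.im * w₂.im + (1 - b ^ 2)) ^ 2 +
        ((b + w₁.re) * w₂.im + (b + w₂.re) * w₁.im) ^ 2 := by
    rw [Complex.sq_norm, Complex.normSq_apply]
    simp only [Complex.add_re, Complex.add_im, Complex.mul_re, Complex.mul_im, Complex.one_re,
      Complex.one_im, Complex.ofReal_re, Complex.ofReal_im]
    ring
  have hk : 0 ≤ 1 - b ^ 2 := by nlinarith
  have hsum : 2 * m ≤ w₁.re + w₂.re :=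
    abs_le_of_sq_le_sq' (by nlinarith [sq_nonneg (w₁.re - w₂.re)]) (by linarith) |>.2
  have hB : (b + m) ^ 2 ≤ (b + w₁.re) * (b + w₂.re) := by
    nlinarith [mul_le_mul_of_nonneg_left hsum hb]
  rcases le_or_gt (1 - b ^ 2) ((b + m) ^ 2) with h | h
  · have hle : (b + m) ^ 2 + (1 - b ^ 2) ≤ ‖1 + (b : ℂ) * (w₁ + w₂) + w₁ * w₂‖ := by
      refine (sq_le_sq₀ (by positivity) (norm_nonneg _)).1 ?_
      rw [hnorm]
      exact sq_add_sq_le_normSq _ _ _ _ _ _ hk h hB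
    nlinarith [sq_nonneg (m + b - g)]
  · have hle : 2 * √(1 - b ^ 2) * (b + m) ≤ ‖1 + (b : ℂ) * (w₁ + w₂) + w₁ * w₂‖ := by
      refine (sq_le_sq₀ (by positivity) (norm_nonneg _)).1 ?_
      rw [hnorm, mul_pow, mul_pow, Real.sq_sqrt hk]
      linarith [four_mul_mul_sq_le_normSq _ _ _ _ w₁.im w₂.im hk hB]
    have hs := Real.sq_sqrt hk
    have hs0 := Real.sqrt_nonneg (1 - b ^ 2)
    set s := √(1 - b ^ 2)
    have hBs : b + m ≤ s := by nlinarith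
    have hs1 : s ≤ 1 := by nlinarith
    have hg' : 1 - (g - b) ^ 2 + 2 * g * m ≤ 2 * (b + m) - b ^ 2 := by
      nlinarith [mul_nonneg (sub_nonneg.2 hg) (by linarith : 0 ≤ g + 1 - 2 * (b + m))]
    nlinarith [mul_nonneg (sub_nonneg.2 hs1) (by linarith : 0 ≤ 1 + s - 2 * (b + m))]

/-- Case `1/4 ≤ θ < 1/2`, `2θ ≤ γ ≤ min{6θ − 1, 1}` of Theorem 3 of the paper:
`|p + z₀/2 + (1/2 − θ)(z₁ + z₂)| ≥ −3(θ − (1+γ)/6)(θ − (1+γ)/2)/θ²`. -/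
theorem stmt_8 (θ γ : ℝ) (hθ1 : 1 / 4 ≤ θ) (hθ2 : θ < 1 / 2)
    (hγ0 : 2 * θ ≤ γ) (hγ1 : γ ≤ min (6 * θ - 1) 1)
    (z₀ z₁ z₂ : ℂ) (h1 : z₁.re ≤ 0) (h2 : z₂.re ≤ 0)
    (h0 : ‖z₀‖ ≤ 2 * γ * Real.sqrt (z₁.re * z₂.re))
    (p : ℂ) (hp : p = (1 - (θ : ℂ) * z₁) * (1 - (θ : ℂ) * z₂)) :
    -3 * (θ - (1 + γ) / 6) * (θ - (1 + γ) / 2) / θ ^ 2 ≤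
      ‖p + z₀ / 2 + ((1 / 2 : ℂ) - (θ : ℂ)) * (z₁ + z₂)‖ := by
  have hθ : 0 < θ := by linarith
  have hθc : (θ : ℂ) ≠ 0 := by exact_mod_cast hθ.ne'
  have hz : 0 ≤ z₁.re * z₂.re := mul_nonneg_of_nonpos_of_nonpos h1 h2
  have key := one_sub_sq_add_le_norm (2 - 1 / (2 * θ)) (γ / (2 * θ)) (θ * √(z₁.re * z₂.re))
    (-((θ : ℂ) * z₁)) (-((θ : ℂ) * z₂))
    (by rw [sub_nonneg, div_le_iff₀ (by positivity)]; linarith)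
    (by rw [sub_le_comm, le_div_iff₀ (by positivity)]; linarith)
    (by rw [le_div_iff₀ (by positivity)]; linarith)
    (by positivity)
    (by rw [Complex.neg_re, Complex.re_ofReal_mul]; nlinarith)
    (by rw [Complex.neg_re, Complex.re_ofReal_mul]; nlinarith)
    (by
      rw [mul_pow, Real.sq_sqrt hz, Complex.neg_re, Complex.neg_re, Complex.re_ofReal_mul,
        Complex.re_ofReal_mul]
      ring)
  have hQ : 1 + ((2 - 1 / (2 * θ) : ℝ) : ℂ) * (-((θ : ℂ) * z₁) + -((θ : ℂ) * z₂)) +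
      -((θ : ℂ) * z₁) * -((θ : ℂ) * z₂) =
      (p + z₀ / 2 + ((1 / 2 : ℂ) - (θ : ℂ)) * (z₁ + z₂)) - z₀ / 2 := by
    rw [hp]
    push_cast
    field_simp
    ring
  rw [hQ] at key
  have htri := norm_sub_le (p + z₀ / 2 + ((1 / 2 : ℂ) - (θ : ℂ)) * (z₁ + z₂)) (z₀ / 2)
  rw [norm_div, Complex.norm_ofNat] at htri
  have hR : -3 * (θ - (1 + γ) / 6) * (θ - (1 + γ) / 2) / θ ^ 2 =
      1 - (γ / (2 * θ) - (2 - 1 / (2 * θ))) ^ 2 := by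
    field_simp
    ring
  have hm : 2 * (γ / (2 * θ)) * (θ * √(z₁.re * z₂.re)) = γ * √(z₁.re * z₂.re) := by
    field_simp
  rw [hR]
  linarith
end

section
/- Let θ > 0 and 0 ≤ γ ≤ 1, and assume that either (1/4 < θ ≤ 1/3 and 0 ≤ γ < 6θ − 1) or (θ > 1/3). Then there exists a constant c > 0, depending only on θ and γ, such that for all complex numbers z₀, z₁, z₂ with Re z₁ ≤ 0, Re z₂ ≤ 0 and |z₀| ≤ 2γ·√((Re z₁)·(Re z₂)), setting p = (1 − θz₁)(1 − θz₂), one has |p + z₀/2 + (1/2 − θ)(z₁ + z₂)| ≥ c. -/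
/-- A product of two complex numbers with `σ² ≤ Re u · Re v` lies outside the parabola
with focus `0` and vertex `σ²`. -/
lemma four_mul_sq_mul_le_im_mul_sq {u v : ℂ} {σ : ℝ} (h : σ ^ 2 ≤ u.re * v.re) :
    4 * σ ^ 2 * (σ ^ 2 - (u * v).re) ≤ (u * v).im ^ 2 := by
  rcases le_total (σ ^ 2) (u * v).re with hX | hX
  · nlinarith [sq_nonneg (u * v).im, mul_nonneg (sq_nonneg σ) (sub_nonneg.2 hX)]
  · have hR : 4 * (u.re * v.re) * (u.re * v.re - (u * v).re) ≤ (u * v).im ^ 2 := by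
      simp only [Complex.mul_re, Complex.mul_im]
      nlinarith [sq_nonneg (u.re * v.im - u.im * v.re)]
    have := mul_le_mul h (sub_le_sub_right h (u * v).re) (sub_nonneg.2 hX)
      ((sq_nonneg σ).trans h)
    linarith

lemma sq_norm_add_ofReal (w : ℂ) (K : ℝ) : ‖w + K‖ ^ 2 = (w.re + K) ^ 2 + w.im ^ 2 := by
  rw [Complex.sq_norm, Complex.normSq_apply]
  simp only [Complex.add_re, Complex.add_im, Complex.ofReal_re, Complex.ofReal_im]
  ring

/-- Distance from `-K` to the exterior of the parabola, when the vertex is the nearest point. -/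
lemma sq_add_le_norm_add_ofReal {w : ℂ} {σ K : ℝ}
    (hw : 4 * σ ^ 2 * (σ ^ 2 - w.re) ≤ w.im ^ 2) (hK : K ≤ σ ^ 2) :
    σ ^ 2 + K ≤ ‖w + K‖ := by
  rcases le_total (σ ^ 2) w.re with hX | hX
  · have := Complex.re_le_norm (w + K)
    simp only [Complex.add_re, Complex.ofReal_re] at this
    linarith
  · refine le_of_sq_le_sq ?_ (norm_nonneg _)
    rw [sq_norm_add_ofReal]
    nlinarith [mul_nonneg (sub_nonneg.2 hX) (sub_nonneg.2 hK), sq_nonneg (σ ^ 2 - w.re)]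

/-- Distance from `-k²` to the exterior of the parabola, when the vertex is not the nearest
point. -/
lemma two_mul_mul_le_norm_add_sq {w : ℂ} {σ k : ℝ}
    (hw : 4 * σ ^ 2 * (σ ^ 2 - w.re) ≤ w.im ^ 2) :
    2 * σ * k ≤ ‖w + (k ^ 2 : ℝ)‖ := by
  refine le_of_sq_le_sq ?_ (norm_nonneg _)
  rw [sq_norm_add_ofReal]
  nlinarith [sq_nonneg (w.re + k ^ 2 - 2 * σ ^ 2)]

lemma min_le_one_sub_sq_add {θ ε q : ℝ} (hθ : 0 < θ) (hε : 0 < ε) (hq : 0 ≤ q) :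
    min (1 / 4) (ε / (2 * θ)) ≤ (1 - θ * q) ^ 2 + ε * q := by
  rcases le_total (θ * q) (1 / 2) with h | h
  · exact (min_le_left _ _).trans (by nlinarith [mul_nonneg hε.le hq])
  · refine (min_le_right _ _).trans ?_
    rw [div_le_iff₀ (by positivity)]
    nlinarith [mul_le_mul_of_nonneg_left h hε.le, mul_nonneg hθ.le (sq_nonneg (1 - θ * q))]

lemma sq_add_mul_sqrt_le {β θ x y : ℝ} (hβ : 0 ≤ β) (hθ : 0 ≤ θ) (hx : 0 ≤ x) (hy : 0 ≤ y) :
    (β + θ * √(x * y)) ^ 2 ≤ (β + θ * x) * (β + θ * y) := by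
  have hs : √(x * y) ^ 2 = x * y := Real.sq_sqrt (mul_nonneg hx hy)
  have h2 : 2 * √(x * y) ≤ x + y := by
    rw [Real.sqrt_mul hx]
    nlinarith [sq_nonneg (√x - √y), Real.sq_sqrt hx, Real.sq_sqrt hy]
  linear_combination θ ^ 2 * hs + β * θ * h2

/-- Uniform gap between the distance to the parabola of parameter `β + θ q` and `γ q`. -/
lemma min_le_norm_sub {β θ γ q : ℝ} {w : ℂ} (hβ : 0 < β) (hθ : 0 < θ)
    (hγ : γ < 2 * β * θ + 2 * θ) (hq : 0 ≤ q)
    (hw : 4 * (β + θ * q) ^ 2 * ((β + θ * q) ^ 2 - w.re) ≤ w.im ^ 2) :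
    min (2 * β ^ 2) (min (1 / 4) ((2 * β * θ + 2 * θ - γ) / (2 * θ))) ≤
      ‖w + (1 - β ^ 2 : ℝ)‖ - γ * q := by
  have hε : 0 < 2 * β * θ + 2 * θ - γ := sub_pos.2 hγ
  rcases le_total (1 - β ^ 2) ((β + θ * q) ^ 2) with hK | hK
  · refine (min_le_right _ _).trans ((min_le_one_sub_sq_add hθ hε hq).trans ?_)
    linarith [sq_add_le_norm_add_ofReal hw hK]
  · obtain ⟨k, hk0, hk⟩ : ∃ k : ℝ, 0 ≤ k ∧ 1 - β ^ 2 = k ^ 2 :=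
      ⟨√(1 - β ^ 2), Real.sqrt_nonneg _, (Real.sq_sqrt ((sq_nonneg _).trans hK)).symm⟩
    rw [hk] at hK ⊢
    have hσk : β + θ * q ≤ k := le_of_sq_le_sq hK hk0
    have hβk : β ≤ k := by nlinarith [mul_nonneg hθ.le hq]
    have hD := two_mul_mul_le_norm_add_sq (k := k) hw
    rcases le_total γ (2 * k * θ) with hs | hs
    · refine (min_le_left _ _).trans ?_
      nlinarith [mul_le_mul_of_nonneg_right hs hq, mul_le_mul_of_nonneg_left hβk hβ.le]
    · have hQ : θ * ((k - β) / θ) = k - β := by field_simp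
      have hQ0 : 0 ≤ (k - β) / θ := div_nonneg (sub_nonneg.2 hβk) hθ.le
      set Q := (k - β) / θ
      have hqQ : q ≤ Q := by
        refine le_of_mul_le_mul_left ?_ hθ
        linarith
      refine (min_le_right _ _).trans ((min_le_one_sub_sq_add hθ hε hQ0).trans ?_)
      have hkQ : k = β + θ * Q := by linarith
      have hend : (1 - θ * Q) ^ 2 + (2 * β * θ + 2 * θ - γ) * Q = 2 * k ^ 2 - γ * Q := by
        have : k ^ 2 = (β + θ * Q) ^ 2 := by rw [← hkQ]
        linarith
      have hslope := mul_le_mul_of_nonneg_right hs (sub_nonneg.2 hqQ)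
      have : 2 * k ^ 2 = 2 * k * (β + θ * Q) := by rw [← hkQ]; ring
      linarith

/-- Corollary of Theorem 3 of the paper: if `1/4 < θ ≤ 1/3` and `0 ≤ γ < 6θ − 1`,
or `θ > 1/3`, then the symbol `p + z₀/2 + (1/2 − θ)(z₁ + z₂)` is bounded away
from zero uniformly over all admissible `z₀, z₁, z₂`. -/
theorem stmt_9 (θ γ : ℝ) (hθ : 0 < θ) (hγ0 : 0 ≤ γ) (hγ1 : γ ≤ 1)
    (hcase : (1 / 4 < θ ∧ θ ≤ 1 / 3 ∧ γ < 6 * θ - 1) ∨ 1 / 3 < θ) :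
    ∃ c : ℝ, 0 < c ∧
      ∀ z₀ z₁ z₂ : ℂ, z₁.re ≤ 0 → z₂.re ≤ 0 →
        ‖z₀‖ ≤ 2 * γ * Real.sqrt (z₁.re * z₂.re) →
        c ≤ ‖((1 - (θ : ℂ) * z₁) * (1 - (θ : ℂ) * z₂)
              + z₀ / 2 + ((1 / 2 : ℂ) - (θ : ℂ)) * (z₁ + z₂))‖ := by
  have hθ4 : 1 / 4 < θ := by rcases hcase with h | h <;> linarith [h]
  have hγ6 : γ < 6 * θ - 1 := by rcases hcase with h | h <;> linarith [h]
  obtain ⟨β, hβ⟩ : ∃ β : ℝ, 2 * β * θ = 4 * θ - 1 :=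
    ⟨(4 * θ - 1) / (2 * θ), by field_simp⟩
  have hβ0 : 0 < β := by
    refine pos_of_mul_pos_left (b := θ) ?_ hθ.le
    linarith
  have hγ : γ < 2 * β * θ + 2 * θ := by linarith
  refine ⟨min (2 * β ^ 2) (min (1 / 4) ((2 * β * θ + 2 * θ - γ) / (2 * θ))),
    lt_min (by positivity) (lt_min (by norm_num) (div_pos (sub_pos.2 hγ) (by positivity))), ?_⟩
  intro z₀ z₁ z₂ h₁ h₂ h₀
  set w : ℂ := (β - θ * z₁) * (β - θ * z₂)
  have hpar := four_mul_sq_mul_le_im_mul_sq (u := β - θ * z₁) (v := β - θ * z₂)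
    (σ := β + θ * √(z₁.re * z₂.re)) (by
      have := sq_add_mul_sqrt_le hβ0.le hθ.le (neg_nonneg.2 h₁) (neg_nonneg.2 h₂)
      rw [neg_mul_neg] at this
      simpa [sub_eq_add_neg] using this)
  have hgap := min_le_norm_sub hβ0 hθ hγ (Real.sqrt_nonneg _) hpar
  have hβC : 2 * (β : ℂ) * θ = 4 * θ - 1 := by exact_mod_cast hβ
  have hsymbol : (1 - (θ : ℂ) * z₁) * (1 - (θ : ℂ) * z₂) + z₀ / 2
      + ((1 / 2 : ℂ) - (θ : ℂ)) * (z₁ + z₂) = (w + (1 - β ^ 2 : ℝ)) + z₀ / 2 := by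
    push_cast
    linear_combination (z₁ + z₂) / 2 * hβC
  have hz : ‖z₀ / 2‖ ≤ γ * √(z₁.re * z₂.re) := by
    rw [norm_div, Complex.norm_two]
    linarith
  have htri := norm_sub_le_norm_add (w + (1 - β ^ 2 : ℝ)) (z₀ / 2)
  rw [hsymbol]
  linarith
end

section
/- Let θ ≥ 0 and let z₁, z₂ be complex numbers with Re z₁ ≤ 0 and Re z₂ ≤ 0. Then |(1 − θz₁)(1 − θz₂)| ≥ 2θ·√((Re z₁)·(Re z₂)) + √(1 + θ²|z₁|²)·√(1 + θ²|z₂|²). -/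
theorem Real.sqrt_mul_sqrt_add_le {a b c d : ℝ} (ha : 0 ≤ a) (hb : 0 ≤ b) (hc : 0 ≤ c)
    (hd : 0 ≤ d) : √a * √b + √c * √d ≤ √(a + c) * √(b + d) := by
  have h := Real.sum_sqrt_mul_sqrt_le Finset.univ (f := ![a, c]) (g := ![b, d])
    (by simp [Fin.forall_fin_two, ha, hc]) (by simp [Fin.forall_fin_two, hb, hd])
  simpa [Fin.sum_univ_two] using h

theorem Complex.norm_one_sub_ofReal_mul (θ : ℝ) (z : ℂ) :
    ‖1 - (θ : ℂ) * z‖ = √(-2 * θ * z.re + (1 + θ ^ 2 * ‖z‖ ^ 2)) := by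
  rw [← Real.sqrt_sq (norm_nonneg (1 - (θ : ℂ) * z))]
  congr 1
  simp only [Complex.sq_norm, Complex.normSq_apply, Complex.sub_re, Complex.sub_im,
    Complex.one_re, Complex.one_im, Complex.re_ofReal_mul, Complex.im_ofReal_mul]
  ring

/-- Cauchy–Schwarz step in the proof of the paper's Theorem 3: for `θ ≥ 0` and
`Re z₁ ≤ 0`, `Re z₂ ≤ 0`,
`|(1 − θz₁)(1 − θz₂)| ≥ 2θ√((Re z₁)(Re z₂)) + √(1 + θ²|z₁|²)·√(1 + θ²|z₂|²)`. -/
theorem stmt_10 (θ : ℝ) (hθ : 0 ≤ θ) (z₁ z₂ : ℂ) (h1 : z₁.re ≤ 0) (h2 : z₂.re ≤ 0) :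
    2 * θ * Real.sqrt (z₁.re * z₂.re) +
      Real.sqrt (1 + θ ^ 2 * ‖z₁‖ ^ 2) *
        Real.sqrt (1 + θ ^ 2 * ‖z₂‖ ^ 2) ≤
    ‖(1 - (θ : ℂ) * z₁) * (1 - (θ : ℂ) * z₂)‖ := by
  have ha : 0 ≤ -2 * θ * z₁.re := by nlinarith [mul_nonneg hθ (neg_nonneg.2 h1)]
  have hb : 0 ≤ -2 * θ * z₂.re := by nlinarith [mul_nonneg hθ (neg_nonneg.2 h2)]
  have hsqrt : 2 * θ * √(z₁.re * z₂.re) = √(-2 * θ * z₁.re) * √(-2 * θ * z₂.re) := by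
    rw [← Real.sqrt_mul ha,
      show -2 * θ * z₁.re * (-2 * θ * z₂.re) = (2 * θ) ^ 2 * (z₁.re * z₂.re) by ring,
      Real.sqrt_mul (sq_nonneg _), Real.sqrt_sq (by positivity)]
  rw [hsqrt, norm_mul, Complex.norm_one_sub_ofReal_mul, Complex.norm_one_sub_ofReal_mul]
  exact Real.sqrt_mul_sqrt_add_le ha hb (by positivity) (by positivity)
end
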